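/- arXiv:1207.3317 — 2 statements merged into one kernel-verified Lean document; each statement's English description precedes it below -/
import Mathlib

section
/- Let A be an infinite set of positive integers with 1 ∈ A such that |A ∩ {1,...,n}| = (1+o(1)) · (log n)/(log log n) as n → ∞. Then there exist a constant c, an integer n₀, and an infinite set M of positive integers such that 0 < p(n,A,M) ≤ n^c for all n > n₀. -/
open Filter

/-- `pCount A M n` is `p(n, A, M)`: the number of finitely supported functions
`m : ℕ → ℕ` with support contained in `A`, nonzero values in `M`, and
`∑_{a ∈ A} m(a) · a = n`. -/
noncomputable def pCount (A M : Set ℕ) (n : ℕ) : ℕ :=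
  {f : ℕ →₀ ℕ | ↑f.support ⊆ A ∧ (∀ a ∈ f.support, f a ∈ M) ∧
    f.sum (fun a m => m * a) = n}.ncard

/-- Mixed-radix expansion: if `s i` is within a factor `2` below `X ^ i`, every `n < X ^ k` is a
combination of `s 0, …, s (k - 1)` with digits less than `2 * X`. -/
lemma exists_digits_of_le_pow (s : ℕ → ℕ) (X : ℕ) :
    ∀ k : ℕ, (∀ i < k, s i ≤ X ^ i ∧ X ^ i ≤ 2 * s i) → ∀ n < X ^ k,
      ∃ d : ℕ → ℕ, (∀ i < k, d i < 2 * X) ∧ ∑ i ∈ Finset.range k, d i * s i = n := by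
  intro k
  induction k with
  | zero =>
    intro _ n hn
    exact ⟨fun _ => 0, by simp, by simp at hn; simp [hn]⟩
  | succ k ih =>
    intro hs n hn
    obtain ⟨hle, hge⟩ := hs k (Nat.lt_succ_self k)
    have hX : 0 < X ^ k := by
      rcases Nat.eq_zero_or_pos (X ^ k) with h | h
      · rw [pow_succ, h] at hn
        omega
      · exact h
    have hspos : 0 < s k := by omega
    obtain ⟨d, hd, hsum⟩ := ih (fun i hi => hs i (by omega)) (n % s k)
      ((Nat.mod_lt n hspos).trans_le hle)
    refine ⟨fun i => if i = k then n / s k else d i, fun i hi => ?_, ?_⟩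
    · by_cases hik : i = k
      · simp only [hik, if_true]
        rw [Nat.div_lt_iff_lt_mul hspos]
        calc n < X ^ k * X := by rwa [← pow_succ]
          _ ≤ 2 * s k * X := Nat.mul_le_mul_right _ hge
          _ = 2 * X * s k := by ring
      · simp only [hik, if_false]
        exact hd i (by omega)
    · simp only [Finset.sum_range_succ, if_true]
      have : ∑ i ∈ Finset.range k, (if i = k then n / s k else d i) * s i
          = ∑ i ∈ Finset.range k, d i * s i :=
        Finset.sum_congr rfl fun i hi => by
          rw [if_neg (by simp at hi; omega)]
      rw [this, hsum]
      exact Nat.mod_add_div' n (s k)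

/-- Multiplicities of the form `L + d * (X ^ i / a i)` with bounded `d` represent every `n` between
`L * ∑ a i` and `X ^ k`. -/
lemma exists_multiplicities (a : ℕ → ℕ) (X L k n : ℕ) (hpos : ∀ i, 0 < a i)
    (ha : ∀ i < k, a i ≤ X ^ i) (hL : L * ∑ i ∈ Finset.range k, a i ≤ n) (hn : n < X ^ k) :
    ∃ d : ℕ → ℕ, (∀ i < k, d i < 2 * X) ∧
      ∑ i ∈ Finset.range k, (L + d i * (X ^ i / a i)) * a i = n := by
  obtain ⟨d, hd, hsum⟩ := exists_digits_of_le_pow (fun i => X ^ i / a i * a i) X k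
    (fun i hi => ⟨Nat.div_mul_le_self _ _, by
      have h₁ : 1 ≤ X ^ i / a i := (Nat.one_le_div_iff (hpos i)).2 (ha i hi)
      have h₂ := Nat.div_add_mod' (X ^ i) (a i)
      have h₃ := Nat.mod_lt (X ^ i) (hpos i)
      have h₄ := Nat.mul_le_mul_right (a i) h₁
      omega⟩) (n - L * ∑ i ∈ Finset.range k, a i) (by omega)
  refine ⟨d, hd, ?_⟩
  have : ∀ i, (L + d i * (X ^ i / a i)) * a i = L * a i + d i * (X ^ i / a i * a i) :=
    fun i => by ring
  simp only [this, Finset.sum_add_distrib, ← Finset.mul_sum]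
  omega

/-- The representations counted by `pCount A M n` take values in any finset containing `0` and
`M ∩ [1, n]`. -/
lemma representations_subset (A M : Set ℕ) (hApos : ∀ a ∈ A, 0 < a) (n : ℕ) (S P : Finset ℕ)
    (hS : (S : Set ℕ) = A ∩ Set.Icc 1 n) (h0 : 0 ∈ P) (hP : ∀ m ∈ M, m ≤ n → m ∈ P) :
    {f : ℕ →₀ ℕ | ↑f.support ⊆ A ∧ (∀ a ∈ f.support, f a ∈ M) ∧
      f.sum (fun a m => m * a) = n} ⊆ (S.finsupp fun _ => P : Finset (ℕ →₀ ℕ)) := by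
  rintro f ⟨hfA, hfM, hsum⟩
  have hle : ∀ a ∈ f.support, f a * a ≤ n := fun a ha => by
    rw [← hsum]
    exact Finset.single_le_sum (f := fun a => f a * a) (fun _ _ => Nat.zero_le _) ha
  rw [Finset.mem_coe, Finset.mem_finsupp_iff]
  refine ⟨fun a ha => ?_, fun a _ => ?_⟩
  · have hap := hApos a (hfA ha)
    have hfa : 0 < f a := Nat.pos_of_ne_zero (Finsupp.mem_support_iff.1 ha)
    rw [← Finset.mem_coe, hS]
    exact ⟨hfA ha, hap, (Nat.le_mul_of_pos_left a hfa).trans (hle a ha)⟩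
  · by_cases ha : a ∈ f.support
    · exact hP _ (hfM a ha)
        ((Nat.le_mul_of_pos_right _ (hApos a (hfA ha))).trans (hle a ha))
    · rw [Finsupp.notMem_support_iff.1 ha]
      exact h0

lemma finite_representations (A M : Set ℕ) (hApos : ∀ a ∈ A, 0 < a) (n : ℕ) :
    {f : ℕ →₀ ℕ | ↑f.support ⊆ A ∧ (∀ a ∈ f.support, f a ∈ M) ∧
      f.sum (fun a m => m * a) = n}.Finite := by
  have hfin : (A ∩ Set.Icc 1 n).Finite := (Set.finite_Icc 1 n).subset Set.inter_subset_right
  exact (Finset.finite_toSet _).subset (representations_subset A M hApos n hfin.toFinset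
    (Finset.range (n + 1)) (by simp) (by simp) (fun m _ hm => by simp; omega))

lemma pCount_le_card_pow (A M : Set ℕ) (hApos : ∀ a ∈ A, 0 < a) (n : ℕ) (P : Finset ℕ)
    (h0 : 0 ∈ P) (hP : ∀ m ∈ M, m ≤ n → m ∈ P) :
    pCount A M n ≤ P.card ^ (A ∩ Set.Icc 1 n).ncard := by
  have hfin : (A ∩ Set.Icc 1 n).Finite := (Set.finite_Icc 1 n).subset Set.inter_subset_right
  have hsub := representations_subset A M hApos n hfin.toFinset P (by simp) h0 hP
  calc pCount A M n ≤ (hfin.toFinset.finsupp fun _ => P).card := by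
        rw [← Set.ncard_coe_finset]
        exact Set.ncard_le_ncard hsub (Finset.finite_toSet _)
    _ = P.card ^ (A ∩ Set.Icc 1 n).ncard := by
        rw [Finset.card_finsupp, Finset.prod_const, Set.ncard_eq_toFinset_card _ hfin]

lemma pCount_pos_of_sum_eq (A M : Set ℕ) (hApos : ∀ a ∈ A, 0 < a) (a : ℕ → ℕ)
    (ha : StrictMono a) (haA : ∀ i, a i ∈ A) (k n : ℕ) (m : ℕ → ℕ) (hm : ∀ i < k, m i ∈ M)
    (hsum : ∑ i ∈ Finset.range k, m i * a i = n) : 0 < pCount A M n := by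
  classical
  rw [pCount, Set.ncard_pos (finite_representations A M hApos n)]
  let g : ℕ →₀ ℕ := Finsupp.onFinset (Finset.range k) (fun i => if i < k then m i else 0)
    (fun i hi => by
      by_contra h
      simp at h hi
      omega)
  have hg : ∀ i, g i = if i < k then m i else 0 := fun _ => rfl
  have hgs : g.support ⊆ Finset.range k := Finsupp.support_onFinset_subset
  refine ⟨g.embDomain ⟨a, ha.injective⟩, ?_, ?_, ?_⟩
  · intro x hx
    simp only [Finsupp.support_embDomain, Finset.coe_map, Set.mem_image] at hx
    obtain ⟨i, -, rfl⟩ := hx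
    exact haA i
  · intro x hx
    rw [Finsupp.support_embDomain, Finset.mem_map] at hx
    obtain ⟨i, hi, rfl⟩ := hx
    have hik := Finset.mem_range.1 (hgs hi)
    rw [Finsupp.embDomain_apply_self, hg, if_pos hik]
    exact hm i hik
  · rw [Finsupp.sum_embDomain, Finsupp.sum_of_support_subset g hgs _ (by simp), ← hsum]
    refine Finset.sum_congr rfl fun i hi => ?_
    rw [hg, if_pos (Finset.mem_range.1 hi)]
    rfl

lemma nth_le_iff_lt_ncard (A : Set ℕ) (hA : A.Infinite) (hApos : ∀ a ∈ A, 0 < a) (i x : ℕ) :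
    Nat.nth (· ∈ A) i ≤ x ↔ i < (A ∩ Set.Icc 1 x).ncard := by
  classical
  have hcount : (A ∩ Set.Icc 1 x).ncard = Nat.count (· ∈ A) (x + 1) := by
    rw [Nat.count_eq_card_filter_range, ← Set.ncard_coe_finset]
    congr 1
    ext y
    simp only [Set.mem_inter_iff, Set.mem_Icc, Finset.coe_filter, Finset.mem_range,
      Set.mem_ofPred_eq]
    constructor
    · rintro ⟨h, -, h'⟩
      exact ⟨by omega, h⟩
    · rintro ⟨h, h'⟩
      exact ⟨h', hApos y h', by omega⟩
  rw [hcount, Nat.lt_nth_iff_count_lt (p := (· ∈ A)) hA, Nat.lt_succ_iff]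

/-- The growth rate `log n / log log n`, up to constants, in terms of integer powers. -/
lemma eventually_pow_log_bounds (F : ℕ → ℕ)
    (hF : Tendsto (fun n : ℕ => (F n : ℝ) * Real.log (Real.log n) / Real.log n)
      atTop (nhds 1)) :
    ∀ᶠ n : ℕ in atTop, n ≤ Nat.log 2 n ^ (2 * F n) ∧ Nat.log 2 n ^ F n ≤ n ^ 4 := by
  have hlog : Tendsto (fun n : ℕ => Real.log n) atTop atTop :=
    Real.tendsto_log_atTop.comp tendsto_natCast_atTop_atTop
  filter_upwards [hF.eventually_const_lt (show (1 / 2 : ℝ) < 1 by norm_num),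
    hF.eventually_lt_const (show (1 : ℝ) < 2 by norm_num),
    hlog.eventually_ge_atTop 3, eventually_ge_atTop 8] with n hlow hup hl3 hn8
  have hlpos : 0 < Real.log n := by linarith
  have hnpos : (0 : ℝ) < n := by positivity
  rw [lt_div_iff₀ hlpos] at hlow
  rw [div_lt_iff₀ hlpos] at hup
  have hℓ3 : 3 ≤ Nat.log 2 n := Nat.le_log_of_pow_le (by norm_num) hn8
  have hℓ3' : (3 : ℝ) ≤ Nat.log 2 n := by exact_mod_cast hℓ3
  have h2 : Real.log 2 < 0.6931471808 := Real.log_two_lt_d9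
  have h2' : 0.6931471803 < Real.log 2 := Real.log_two_gt_d9
  have hlogle : Real.log n ≤ Nat.log 2 n := by
    have h : (n : ℝ) ≤ 2 ^ (Nat.log 2 n + 1) := by
      exact_mod_cast (Nat.lt_pow_succ_log_self (by norm_num) n).le
    have := Real.log_le_log hnpos h
    rw [Real.log_pow] at this
    push_cast at this
    nlinarith
  have hlelog : (Nat.log 2 n : ℝ) ≤ Real.log n ^ 2 := by
    have h : (2 : ℝ) ^ Nat.log 2 n ≤ n := by
      exact_mod_cast Nat.pow_log_le_self 2 (by omega)
    have := Real.log_le_log (by positivity) h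
    rw [Real.log_pow] at this
    nlinarith
  constructor
  · have hkey : Real.log n ≤ Real.log ((Nat.log 2 n : ℝ) ^ (2 * F n)) := by
      rw [Real.log_pow]
      have h₁ := Real.log_le_log hlpos hlogle
      have h₂ := mul_le_mul_of_nonneg_left h₁ (Nat.cast_nonneg (α := ℝ) (F n))
      push_cast
      linarith
    have := (Real.log_le_log_iff hnpos (by positivity)).1 hkey
    exact_mod_cast this
  · have hkey : Real.log ((Nat.log 2 n : ℝ) ^ F n) ≤ Real.log ((n : ℝ) ^ 4) := by
      rw [Real.log_pow, Real.log_pow]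
      have h₁ := Real.log_le_log (by positivity) hlelog
      rw [Real.log_pow] at h₁
      have h₂ := mul_le_mul_of_nonneg_left h₁ (Nat.cast_nonneg (α := ℝ) (F n))
      push_cast at h₂ ⊢
      linarith
    have := (Real.log_le_log_iff (by positivity) (by positivity)).1 hkey
    exact_mod_cast this

/-- If the counting function `F` of a strictly increasing sequence `a` satisfies
`x ≤ (log₂ x) ^ (2 * F x)` for large `x`, then the terms of `a` up to `2 ^ u` obey
`a i ≤ (u ^ 16) ^ i`. -/
lemma seq_le_pow_of_counting (a F : ℕ → ℕ) (ha0 : a 0 = 1)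
    (hF : ∀ i x, a i ≤ x ↔ i < F x) (N : ℕ)
    (hgrow : ∀ x ≥ N, x ≤ Nat.log 2 x ^ (2 * F x)) (u : ℕ) (hu : 2 ≤ u) (huN : N ≤ u)
    (i : ℕ) (hi : a i ≤ 2 ^ u) : a i ≤ (u ^ 16) ^ i := by
  rcases Nat.eq_zero_or_pos i with rfl | hipos
  · simp [ha0]
  have hle : u ≤ (u ^ 16) ^ i := by
    rw [← pow_mul]
    exact Nat.le_self_pow (by omega) u
  by_cases hsmall : a i ≤ N
  · omega
  have hFi : F (a i - 1) ≤ i := by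
    have := (hF i (a i - 1)).not
    omega
  have hlog : Nat.log 2 (a i - 1) ≤ u := by
    calc Nat.log 2 (a i - 1) ≤ Nat.log 2 (2 ^ u) := Nat.log_mono_right (by omega)
      _ = u := Nat.log_pow (by norm_num) u
  have h₁ : a i - 1 ≤ u ^ (2 * i) :=
    calc a i - 1 ≤ Nat.log 2 (a i - 1) ^ (2 * F (a i - 1)) := hgrow _ (by omega)
      _ ≤ u ^ (2 * F (a i - 1)) := Nat.pow_le_pow_left hlog _
      _ ≤ u ^ (2 * i) := Nat.pow_le_pow_right (by omega) (by omega)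
  have h₂ : 1 ≤ u ^ (2 * i) := Nat.one_le_pow _ _ (by omega)
  calc a i ≤ u ^ (2 * i) * 2 := by omega
    _ ≤ u ^ (2 * i) * u := Nat.mul_le_mul_left _ hu
    _ = u ^ (2 * i + 1) := (pow_succ _ _).symm
    _ ≤ u ^ (16 * i) := Nat.pow_le_pow_right (by omega) (by omega)
    _ = (u ^ 16) ^ i := by rw [← pow_mul]

/-- The set of multiplicities used to represent the integers in `[16 ^ u, 16 ^ (u + 1))`, for all
`u ≥ u₀`. -/
def multiplicitySet (a F : ℕ → ℕ) (u₀ : ℕ) : Set ℕ :=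
  {m | ∃ u ≥ u₀, ∃ i < F (2 ^ u), ∃ d < 2 * u ^ 16, m = 2 ^ u + d * ((u ^ 16) ^ i / a i)}

lemma exists_sum_multiplicitySet (a F : ℕ → ℕ) (ha : StrictMono a) (ha0 : a 0 = 1)
    (hF : ∀ i x, a i ≤ x ↔ i < F x) (N : ℕ)
    (hgrow : ∀ x ≥ N, x ≤ Nat.log 2 x ^ (2 * F x)) (u₀ : ℕ) (hu₀ : 2 ≤ u₀) (hu₀N : N ≤ u₀)
    (n : ℕ) (hn : 16 ^ u₀ ≤ n) :
    ∃ k : ℕ, ∃ m : ℕ → ℕ, (∀ i < k, m i ∈ multiplicitySet a F u₀) ∧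
      ∑ i ∈ Finset.range k, m i * a i = n := by
  have hn0 : n ≠ 0 := by
    have : 0 < 16 ^ u₀ := by positivity
    omega
  obtain ⟨u, hu⟩ : ∃ u, u = Nat.log 16 n := ⟨_, rfl⟩
  have huu₀ : u₀ ≤ u := hu ▸ Nat.le_log_of_pow_le (by norm_num) hn
  have hlow : 16 ^ u ≤ n := hu ▸ Nat.pow_log_le_self 16 hn0
  have hup : n < 16 ^ (u + 1) := hu ▸ Nat.lt_pow_succ_log_self (by norm_num) n
  have hpos : ∀ i, 0 < a i := fun i => by
    have := ha.monotone (Nat.zero_le i)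
    omega
  have hcard : F (2 ^ u) ≤ 2 ^ u := by
    by_contra! h
    have h₁ := (hF _ _).2 h
    have h₂ : ∀ j, j < a j := fun j => by
      induction j with
      | zero => omega
      | succ j ih =>
        have := ha (Nat.lt_add_one j)
        omega
    have := h₂ (2 ^ u)
    omega
  have hsum : 2 ^ u * ∑ i ∈ Finset.range (F (2 ^ u)), a i ≤ n :=
    calc 2 ^ u * ∑ i ∈ Finset.range (F (2 ^ u)), a i
        ≤ 2 ^ u * (F (2 ^ u) * 2 ^ u) := by
          refine Nat.mul_le_mul_left _ ?_
          refine (Finset.sum_le_card_nsmul _ _ (2 ^ u) fun i hi => ?_).trans (by simp)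
          exact (hF _ _).2 (Finset.mem_range.1 hi)
      _ ≤ 2 ^ u * (2 ^ u * 2 ^ u) := by gcongr
      _ ≤ 2 ^ u * (2 ^ u * 2 ^ u) * 2 ^ u := Nat.le_mul_of_pos_right _ (by positivity)
      _ = 16 ^ u := by
          rw [show 16 = 2 * 2 * 2 * 2 by norm_num, mul_pow, mul_pow, mul_pow]
          ring
      _ ≤ n := hlow
  have hlt : n < (u ^ 16) ^ F (2 ^ u) := by
    have hN : N ≤ 2 ^ u := (hu₀N.trans huu₀).trans Nat.lt_two_pow_self.le
    have h := hgrow _ hN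
    rw [Nat.log_pow (by norm_num)] at h
    calc n < 16 ^ (u + 1) := hup
      _ = 2 ^ (4 * (u + 1)) := by rw [pow_mul]; norm_num
      _ ≤ 2 ^ (u * 8) := Nat.pow_le_pow_right (by norm_num) (by omega)
      _ = (2 ^ u) ^ 8 := pow_mul _ _ _
      _ ≤ (u ^ (2 * F (2 ^ u))) ^ 8 := Nat.pow_le_pow_left h 8
      _ = (u ^ 16) ^ F (2 ^ u) := by
          rw [← pow_mul, ← pow_mul]
          congr 1
          ring
  obtain ⟨d, hd, hdsum⟩ := exists_multiplicities a (u ^ 16) (2 ^ u) (F (2 ^ u)) n hpos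
    (fun i hi => seq_le_pow_of_counting a F ha0 hF N hgrow u (by omega) (by omega) i
      ((hF _ _).2 hi)) hsum hlt
  exact ⟨_, _, fun i hi => ⟨u, huu₀, i, hi, d i, hd i hi, rfl⟩, hdsum⟩

/-- Up to `n`, the multiplicity set has at most polylogarithmically many elements. -/
lemma exists_finset_multiplicitySet (a F : ℕ → ℕ) (N : ℕ)
    (hgrow : ∀ x ≥ N, Nat.log 2 x ^ F x ≤ x ^ 4) (u₀ : ℕ) (hu₀ : 2 ≤ u₀) (hu₀N : N ≤ u₀)
    (n : ℕ) (hn : 17 ≤ Nat.log 2 n) :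
    ∃ P : Finset ℕ, 0 ∈ P ∧ (∀ m ∈ multiplicitySet a F u₀, m ≤ n → m ∈ P) ∧
      P.card ≤ Nat.log 2 n ^ 19 := by
  classical
  set l := Nat.log 2 n
  refine ⟨insert 0 ((Finset.range (l + 1) ×ˢ Finset.range (4 * l) ×ˢ
    Finset.range (2 * l ^ 16)).image fun t => 2 ^ t.1 + t.2.2 * ((t.1 ^ 16) ^ t.2.1 / a t.2.1)),
    Finset.mem_insert_self _ _, ?_, ?_⟩
  · rintro m ⟨u, hu, i, hi, d, hd, rfl⟩ hmn
    have hul : u ≤ l := Nat.le_log_of_pow_le (by norm_num) (le_of_add_le_left hmn)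
    have hFu : F (2 ^ u) ≤ 4 * u := by
      have h := hgrow (2 ^ u) ((hu₀N.trans hu).trans Nat.lt_two_pow_self.le)
      rw [Nat.log_pow (by norm_num)] at h
      have h' : 2 ^ F (2 ^ u) ≤ 2 ^ (u * 4) :=
        calc 2 ^ F (2 ^ u) ≤ u ^ F (2 ^ u) := Nat.pow_le_pow_left (by omega) _
          _ ≤ (2 ^ u) ^ 4 := h
          _ = 2 ^ (u * 4) := (pow_mul _ _ _).symm
      have := (Nat.pow_le_pow_iff_right (by norm_num)).1 h'
      omega
    have hpow : u ^ 16 ≤ l ^ 16 := Nat.pow_le_pow_left hul 16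
    refine Finset.mem_insert_of_mem (Finset.mem_image.2 ⟨(u, i, d), ?_, rfl⟩)
    simp only [Finset.mem_product, Finset.mem_range]
    omega
  · refine (Finset.card_insert_le _ _).trans ?_
    refine (Nat.add_le_add_right Finset.card_image_le 1).trans ?_
    simp only [Finset.card_product, Finset.card_range]
    have hone : 1 ≤ l ^ 18 := Nat.one_le_pow _ _ (by omega)
    calc (l + 1) * (4 * l * (2 * l ^ 16)) + 1
        ≤ (2 * l) * (4 * l * (2 * l ^ 16)) + l ^ 18 := by gcongr; omega
      _ = 17 * l ^ 18 := by ring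
      _ ≤ l * l ^ 18 := Nat.mul_le_mul_right _ hn
      _ = l ^ 19 := by ring

theorem stmt5 (A : Set ℕ) (hA : A.Infinite) (hApos : ∀ a ∈ A, 0 < a) (h1 : 1 ∈ A)
    (hdens : Tendsto
      (fun n : ℕ => ((A ∩ Set.Icc 1 n).ncard : ℝ) * Real.log (Real.log n) / Real.log n)
      atTop (nhds 1)) :
    ∃ (c : ℝ) (n₀ : ℕ) (M : Set ℕ), M.Infinite ∧ (∀ m ∈ M, 0 < m) ∧
      ∀ n : ℕ, n > n₀ → 0 < pCount A M n ∧ (pCount A M n : ℝ) ≤ (n : ℝ) ^ c := by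
  obtain ⟨N, hN⟩ := eventually_atTop.1
    (eventually_pow_log_bounds (fun n => (A ∩ Set.Icc 1 n).ncard) hdens)
  set F : ℕ → ℕ := fun n => (A ∩ Set.Icc 1 n).ncard
  set a : ℕ → ℕ := Nat.nth (· ∈ A)
  have ha : StrictMono a := Nat.nth_strictMono hA
  have haA : ∀ i, a i ∈ A := fun i => Nat.nth_mem_of_infinite hA i
  have hF : ∀ i x, a i ≤ x ↔ i < F x := nth_le_iff_lt_ncard A hA hApos
  have hF1 : ∀ x ≥ 1, 0 < F x := fun x hx =>
    (Set.ncard_pos ((Set.finite_Icc 1 x).subset Set.inter_subset_right)).2 ⟨1, h1, le_rfl, hx⟩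
  have ha0 : a 0 = 1 := le_antisymm ((hF 0 1).2 (hF1 1 le_rfl)) (hApos _ (haA 0))
  let u₀ := N + 17
  refine ⟨(76 : ℕ), 16 ^ u₀, multiplicitySet a F u₀, ?_, ?_, fun n hn => ⟨?_, ?_⟩⟩
  · refine Set.infinite_of_not_bddAbove fun ⟨b, hb⟩ => ?_
    have hmem : 2 ^ (u₀ + b) ∈ multiplicitySet a F u₀ :=
      ⟨u₀ + b, by omega, 0, hF1 _ Nat.one_le_two_pow, 0, by positivity, by simp⟩
    have h₁ := hb hmem
    have h₂ : u₀ + b < 2 ^ (u₀ + b) := Nat.lt_two_pow_self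
    omega
  · rintro m ⟨u, -, i, -, d, -, rfl⟩
    positivity
  · obtain ⟨k, m, hm, hsum⟩ := exists_sum_multiplicitySet a F ha ha0 hF N
      (fun x hx => (hN x hx).1) u₀ (by omega) (by omega) n hn.le
    exact pCount_pos_of_sum_eq A _ hApos a ha haA k n m hm hsum
  · have hpow : 2 ^ u₀ ≤ n := (Nat.pow_le_pow_left (by norm_num) u₀).trans hn.le
    have hlog : u₀ ≤ Nat.log 2 n := Nat.le_log_of_pow_le (by norm_num) hpow
    have hNn : N ≤ n := by
      have : u₀ < 2 ^ u₀ := Nat.lt_two_pow_self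
      omega
    obtain ⟨P, h0, hP, hcard⟩ := exists_finset_multiplicitySet a F N
      (fun x hx => (hN x hx).2) u₀ (by omega) (by omega) n (by omega)
    have hle : pCount A (multiplicitySet a F u₀) n ≤ n ^ 76 :=
      calc pCount A (multiplicitySet a F u₀) n
          ≤ P.card ^ F n := pCount_le_card_pow A _ hApos n P h0 hP
        _ ≤ (Nat.log 2 n ^ 19) ^ F n := Nat.pow_le_pow_left hcard _
        _ = (Nat.log 2 n ^ F n) ^ 19 := by rw [← pow_mul, ← pow_mul, mul_comm]
        _ ≤ (n ^ 4) ^ 19 := Nat.pow_le_pow_left (hN n hNn).2 19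
        _ = n ^ 76 := by rw [← pow_mul]
    rw [Real.rpow_natCast]
    exact_mod_cast hle
end

section
/- Let A = {k! : k ≥ 1} be the set of factorials. Then there exist a constant c, an integer n₀, and an infinite set M of positive integers such that 0 < p(n,A,M) ≤ n^c for all n > n₀. -/
open Filter

/-- Factorial-base expansion: every `r < (L + 1)!` has digits `v k ≤ k + 1` at `(k + 1)!`. -/
lemma exists_factorial_digits (L : ℕ) : ∀ r < (L + 1).factorial,
    ∃ v : ℕ → ℕ, (∀ k, v k ≤ k + 1) ∧
      ∑ k ∈ Finset.range L, v k * (k + 1).factorial = r := by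
  induction L with
  | zero =>
    intro r hr
    refine ⟨fun _ => 0, fun _ => Nat.zero_le _, ?_⟩
    simp at hr
    simp [hr]
  | succ L ih =>
    intro r hr
    have hpos := Nat.factorial_pos (L + 1)
    obtain ⟨v, hv, hsum⟩ := ih (r % (L + 1).factorial) (Nat.mod_lt _ hpos)
    refine ⟨Function.update v L (r / (L + 1).factorial), fun k => ?_, ?_⟩
    · rcases eq_or_ne k L with rfl | hk
      · rw [Function.update_self]
        rw [Nat.factorial_succ (k + 1)] at hr
        exact Nat.lt_succ_iff.mp (Nat.div_lt_of_lt_mul (by linarith))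
      · rw [Function.update_of_ne hk]
        exact hv k
    · rw [Finset.sum_range_succ, Function.update_self]
      have hcongr : ∑ k ∈ Finset.range L,
          Function.update v L (r / (L + 1).factorial) k * (k + 1).factorial =
          ∑ k ∈ Finset.range L, v k * (k + 1).factorial :=
        Finset.sum_congr rfl fun k hk => by
          rw [Function.update_of_ne (Finset.mem_range.mp hk).ne]
      rw [hcongr, hsum, mul_comm]
      exact Nat.mod_add_div _ _

/-- Greedy approximation of `R` by multiples of factorials whose coefficients are `0` or powers
of two: the remainder is below `L!` or is at most `R / 2 ^ L`. -/
lemma exists_greedy_approx (L R : ℕ) : ∃ (x : ℕ → ℕ) (r : ℕ),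
    (∀ k, x k = 0 ∨ ∃ a, x k = 2 ^ a) ∧
      ∑ k ∈ Finset.range L, x k * (k + 1).factorial + r = R ∧
      (r < L.factorial ∨ r * 2 ^ L ≤ R) := by
  induction L with
  | zero => exact ⟨fun _ => 0, R, by simp⟩
  | succ L ih =>
    obtain ⟨x, r, hx, hsum, hr⟩ := ih
    have hcongr : ∀ t, ∑ k ∈ Finset.range L, Function.update x L t k * (k + 1).factorial =
        ∑ k ∈ Finset.range L, x k * (k + 1).factorial := fun t =>
      Finset.sum_congr rfl fun k hk => by
        rw [Function.update_of_ne (Finset.mem_range.mp hk).ne]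
    have hupd : ∀ t, (t = 0 ∨ ∃ a, t = 2 ^ a) →
        ∀ k, Function.update x L t k = 0 ∨ ∃ a, Function.update x L t k = 2 ^ a := by
      intro t ht k
      rcases eq_or_ne k L with rfl | hk
      · simpa using ht
      · simpa [Function.update_of_ne hk] using hx k
    have hpos := Nat.factorial_pos (L + 1)
    have hmono : L.factorial ≤ (L + 1).factorial := Nat.factorial_le (Nat.le_succ L)
    by_cases hlt : r < (L + 1).factorial
    · refine ⟨Function.update x L 0, r, hupd 0 (Or.inl rfl), ?_, Or.inl hlt⟩
      rw [Finset.sum_range_succ, Function.update_self, hcongr]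
      simpa using hsum
    · have hrR : r * 2 ^ L ≤ R := hr.resolve_left (by omega)
      set q := r / (L + 1).factorial with hq
      have hq0 : q ≠ 0 := (Nat.div_pos (not_lt.mp hlt) hpos).ne'
      have hle : 2 ^ Nat.log 2 q ≤ q := Nat.pow_log_le_self 2 hq0
      have hgt : q + 1 ≤ 2 ^ (Nat.log 2 q + 1) := Nat.lt_pow_succ_log_self (by norm_num) q
      set a := Nat.log 2 q
      have hlow : 2 ^ a * (L + 1).factorial ≤ r :=
        (Nat.mul_le_mul_right _ hle).trans (Nat.div_mul_le_self _ _)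
      have hhigh : r < 2 * (2 ^ a * (L + 1).factorial) := by
        calc r < (q + 1) * (L + 1).factorial := by
              rw [mul_comm]; exact Nat.lt_mul_div_succ r hpos
          _ ≤ 2 ^ (a + 1) * (L + 1).factorial := Nat.mul_le_mul_right _ hgt
          _ = _ := by ring
      refine ⟨Function.update x L (2 ^ a), r - 2 ^ a * (L + 1).factorial,
        hupd _ (Or.inr ⟨a, rfl⟩), ?_, Or.inr ?_⟩
      · rw [Finset.sum_range_succ, Function.update_self, hcongr]
        omega
      · calc (r - 2 ^ a * (L + 1).factorial) * 2 ^ (L + 1)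
            = (2 * (r - 2 ^ a * (L + 1).factorial)) * 2 ^ L := by ring
          _ ≤ r * 2 ^ L := Nat.mul_le_mul_right _ (by omega)
          _ ≤ R := hrR

lemma sum_factorial_le (L : ℕ) :
    ∑ k ∈ Finset.range L, (k + 1).factorial ≤ 2 * L.factorial := by
  induction L with
  | zero => simp
  | succ L ih =>
    rw [Finset.sum_range_succ]
    rcases L with _ | L
    · simp
    · have : (L + 1 + 1).factorial = (L + 2) * (L + 1).factorial := Nat.factorial_succ _
      nlinarith [Nat.factorial_pos (L + 1), Nat.zero_le (L * (L + 1).factorial)]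

/-- The numbers `x + 2 ^ b + v` with `x` zero or a power of two, and `v ≤ 2 b + 1`. -/
def sparseMultipliers : Set ℕ :=
  {m | ∃ x b v : ℕ, (x = 0 ∨ ∃ a, x = 2 ^ a) ∧ v ≤ 2 * b + 1 ∧ m = x + 2 ^ b + v}

lemma sparseMultipliers_pos {m : ℕ} (hm : m ∈ sparseMultipliers) : 0 < m := by
  obtain ⟨x, b, v, -, -, rfl⟩ := hm
  have : 0 < 2 ^ b := by positivity
  omega

lemma sparseMultipliers_infinite : sparseMultipliers.Infinite :=
  Set.infinite_of_injective_forall_mem (f := fun b : ℕ => 2 ^ b)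
    (Nat.pow_right_injective le_rfl) fun b => ⟨0, b, 0, Or.inl rfl, Nat.zero_le _, by simp⟩

lemma exists_finset_sparseMultipliers (n : ℕ) : ∃ B : Finset ℕ,
    (∀ m ≤ n, m = 0 ∨ m ∈ sparseMultipliers → m ∈ B) ∧ B.card ≤ (Nat.log 2 n + 2) ^ 4 := by
  set l := Nat.log 2 n with hl
  let X : Finset ℕ := insert 0 ((Finset.range (l + 1)).image fun a => 2 ^ a)
  let T := X ×ˢ (Finset.range (l + 1) ×ˢ Finset.range (2 * l + 2))
  have hX : X.card ≤ l + 2 :=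
    (Finset.card_insert_le _ _).trans
      (Nat.succ_le_succ (Finset.card_image_le.trans (Finset.card_range _).le))
  have hT : T.card ≤ (l + 2) * ((l + 1) * (2 * l + 2)) := by
    rw [Finset.card_product, Finset.card_product, Finset.card_range, Finset.card_range]
    exact Nat.mul_le_mul_right _ hX
  refine ⟨insert 0 (T.image fun t => t.1 + 2 ^ t.2.1 + t.2.2), ?_, ?_⟩
  · rintro m hmn (rfl | ⟨x, b, v, hx, hv, rfl⟩)
    · exact Finset.mem_insert_self _ _
    · refine Finset.mem_insert_of_mem (Finset.mem_image.mpr ⟨(x, b, v), ?_, rfl⟩)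
      have hb : b ≤ l := Nat.le_log_of_pow_le (by norm_num) (by omega)
      refine Finset.mem_product.mpr ⟨?_, Finset.mem_product.mpr ⟨?_, ?_⟩⟩
      · rcases hx with rfl | ⟨a, rfl⟩
        · exact Finset.mem_insert_self _ _
        · have ha : a ≤ l := Nat.le_log_of_pow_le (by norm_num)
            (((Nat.le_add_right _ _).trans (Nat.le_add_right _ _)).trans hmn)
          exact Finset.mem_insert_of_mem
            (Finset.mem_image.mpr ⟨a, Finset.mem_range.mpr (by omega), rfl⟩)
      · exact Finset.mem_range.mpr (by show b < _; omega)
      · exact Finset.mem_range.mpr (by show v < _; omega)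
  · calc _ ≤ (l + 2) * ((l + 1) * (2 * l + 2)) + 1 :=
          (Finset.card_insert_le _ _).trans (Nat.succ_le_succ (Finset.card_image_le.trans hT))
      _ ≤ (l + 2) ^ 4 := by ring_nf; nlinarith [Nat.zero_le (l ^ 3), Nat.zero_le (l ^ 4)]

lemma pow_self_le_factorial_sq (K : ℕ) : K ^ K ≤ K.factorial ^ 2 := by
  have hrefl : ∏ i ∈ Finset.range K, (K - i) = K.factorial := by
    rw [← Finset.prod_range_add_one_eq_factorial, ← Finset.prod_range_reflect]
    refine Finset.prod_congr rfl fun i hi => ?_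
    have := Finset.mem_range.mp hi
    omega
  calc K ^ K = ∏ _i ∈ Finset.range K, K := by simp
    _ ≤ ∏ i ∈ Finset.range K, (i + 1) * (K - i) := by
      refine Finset.prod_le_prod' fun i hi => ?_
      have := Finset.mem_range.mp hi
      obtain ⟨d, rfl⟩ : ∃ d, K = i + 1 + d := ⟨K - (i + 1), by omega⟩
      have : i + 1 + d - i = d + 1 := by omega
      rw [this]
      nlinarith [Nat.zero_le (i * d)]
    _ = K.factorial ^ 2 := by
      rw [Finset.prod_mul_distrib, hrefl, Finset.prod_range_add_one_eq_factorial, sq]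

lemma exists_factorial_le_lt {n : ℕ} (hn : 1 ≤ n) :
    ∃ K : ℕ, K.factorial ≤ n ∧ n < (K + 1).factorial := by
  have hex : ∃ k : ℕ, n < (k + 1).factorial :=
    ⟨n, (Nat.lt_succ_self n).trans_le (Nat.self_le_factorial _)⟩
  refine ⟨Nat.find hex, ?_, Nat.find_spec hex⟩
  rcases h : Nat.find hex with _ | k
  · simpa using hn
  · exact not_lt.mp (Nat.find_min hex (m := k) (by omega))

lemma log_le_of_lt_factorial {n K : ℕ} (hn : n < (K + 1).factorial) :
    Nat.log 2 n ≤ (K + 1) ^ 2 := by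
  have h : n ≤ 2 ^ ((K + 1) ^ 2) := by
    calc n ≤ (K + 1) ^ (K + 1) := hn.le.trans (Nat.factorial_le_pow (K + 1))
      _ ≤ (2 ^ (K + 1)) ^ (K + 1) := Nat.pow_le_pow_left Nat.lt_two_pow_self.le _
      _ = _ := by rw [← pow_mul, sq]
  calc _ ≤ Nat.log 2 (2 ^ ((K + 1) ^ 2)) := Nat.log_mono_right h
    _ = _ := Nat.log_pow (by norm_num) _

/-- The representations counted by `pCount`, for the factorials and `sparseMultipliers`. -/
def factorialReps (n : ℕ) : Set (ℕ →₀ ℕ) :=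
  {f | ↑f.support ⊆ {x | ∃ k : ℕ, 1 ≤ k ∧ x = Nat.factorial k} ∧
    (∀ a ∈ f.support, f a ∈ sparseMultipliers) ∧ f.sum (fun a m => m * a) = n}

lemma mul_le_of_mem_factorialReps {n : ℕ} {f : ℕ →₀ ℕ} (hf : f ∈ factorialReps n) (a : ℕ) :
    f a * a ≤ n := by
  by_cases ha : a ∈ f.support
  · rw [← hf.2.2]
    exact Finset.single_le_sum (f := fun a => f a * a) (fun _ _ => Nat.zero_le _) ha
  · simp [Finsupp.notMem_support_iff.mp ha]

lemma factorialReps_finite_ncard_le {n K : ℕ} (hK : n < (K + 1).factorial) :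
    (factorialReps n).Finite ∧ (factorialReps n).ncard ≤ ((Nat.log 2 n + 2) ^ 4) ^ K := by
  obtain ⟨B, hB, hcard⟩ := exists_finset_sparseMultipliers n
  let g : (ℕ →₀ ℕ) → (Fin K → ℕ) := fun f k => f ((k : ℕ) + 1).factorial
  let P : Finset (Fin K → ℕ) := Fintype.piFinset fun _ => B
  have hmaps : ∀ f ∈ factorialReps n, g f ∈ (P : Set (Fin K → ℕ)) := by
    intro f hf
    refine Finset.mem_coe.mpr (Fintype.mem_piFinset.mpr fun k => hB _ ?_ ?_)
    · exact (Nat.le_mul_of_pos_right _ (Nat.factorial_pos _)).trans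
        (mul_le_of_mem_factorialReps hf _)
    · by_cases h : f ((k : ℕ) + 1).factorial = 0
      · exact Or.inl h
      · exact Or.inr (hf.2.1 _ (Finsupp.mem_support_iff.mpr h))
  have hzero : ∀ f ∈ factorialReps n, ∀ a,
      (∀ k : Fin K, a ≠ ((k : ℕ) + 1).factorial) → f a = 0 := by
    intro f hf a ha
    by_contra h
    obtain ⟨k, hk1, rfl⟩ := hf.1 (Finset.mem_coe.mpr (Finsupp.mem_support_iff.mpr h))
    have hle : k.factorial ≤ n :=
      (Nat.le_mul_of_pos_left _ (Nat.pos_of_ne_zero h)).trans (mul_le_of_mem_factorialReps hf _)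
    have hkK : k < K + 1 := by
      by_contra hcon
      exact absurd (Nat.factorial_le (not_lt.mp hcon)) (by omega)
    exact ha ⟨k - 1, by omega⟩ (by simp [Nat.sub_add_cancel hk1])
  have hinj : Set.InjOn g (factorialReps n) := by
    intro f₁ h₁ f₂ h₂ h
    ext a
    by_cases ha : ∃ k : Fin K, a = ((k : ℕ) + 1).factorial
    · obtain ⟨k, rfl⟩ := ha
      exact congrFun h k
    · push Not at ha
      rw [hzero f₁ h₁ a ha, hzero f₂ h₂ a ha]
  refine ⟨Set.Finite.of_injOn hmaps hinj P.finite_toSet, ?_⟩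
  calc _ ≤ (P : Set (Fin K → ℕ)).ncard := Set.ncard_le_ncard_of_injOn g hmaps hinj P.finite_toSet
    _ = B.card ^ K := by
      rw [Set.ncard_coe_finset, Fintype.card_piFinset_const]
    _ ≤ _ := Nat.pow_le_pow_left hcard K

lemma log_pow_le_pow {n K : ℕ} (hK : 4 ≤ K) (hle : K.factorial ≤ n)
    (hlt : n < (K + 1).factorial) : ((Nat.log 2 n + 2) ^ 4) ^ K ≤ n ^ 24 := by
  have hlog : Nat.log 2 n + 2 ≤ K ^ 3 := by
    have := log_le_of_lt_factorial hlt
    nlinarith [mul_le_mul hK (le_refl (K ^ 2)) (Nat.zero_le _) (Nat.zero_le _)]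
  calc ((Nat.log 2 n + 2) ^ 4) ^ K ≤ ((K ^ 3) ^ 4) ^ K := by gcongr
    _ = (K ^ K) ^ 12 := by rw [← pow_mul, ← pow_mul, ← pow_mul]; ring_nf
    _ ≤ (K.factorial ^ 2) ^ 12 := Nat.pow_le_pow_left (pow_self_le_factorial_sq K) _
    _ = K.factorial ^ 24 := by rw [← pow_mul]
    _ ≤ n ^ 24 := Nat.pow_le_pow_left hle _

lemma mul_two_pow_half_le {L : ℕ} (hL : 16 ≤ L) : L * 2 ^ (L / 2 + 2) ≤ 2 ^ L := by
  have h : ∀ b, 8 ≤ b → 2 * b + 1 ≤ 2 ^ (b - 2) := by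
    intro b hb
    induction b, hb using Nat.le_induction with
    | base => norm_num
    | succ b hb ih =>
      have : 2 ^ (b + 1 - 2) = 2 * 2 ^ (b - 2) := by
        rw [← pow_succ']; congr 1; omega
      omega
  calc L * 2 ^ (L / 2 + 2) ≤ 2 ^ (L / 2 - 2) * 2 ^ (L / 2 + 2) :=
        Nat.mul_le_mul_right _ ((by omega : L ≤ 2 * (L / 2) + 1).trans (h _ (by omega)))
    _ = 2 ^ (L / 2 - 2 + (L / 2 + 2)) := (pow_add _ _ _).symm
    _ ≤ 2 ^ L := Nat.pow_le_pow_right (by norm_num) (by omega)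

/-- `L` is taken least with `n ≤ 2 ^ L * L!`. -/
lemma exists_scale {n : ℕ} (hn : 2 ^ 16 * Nat.factorial 16 < n) : ∃ L : ℕ, 16 ≤ L ∧
    n ≤ 2 ^ L * L.factorial ∧ 2 ^ (L / 2) * (2 * L.factorial) ≤ n := by
  have hex : ∃ L : ℕ, n ≤ 2 ^ L * L.factorial :=
    ⟨n, (Nat.self_le_factorial n).trans (Nat.le_mul_of_pos_left _ (by positivity))⟩
  have hspec := Nat.find_spec hex
  have hmin : ∀ m, m < Nat.find hex → ¬ n ≤ 2 ^ m * m.factorial := fun m => Nat.find_min hex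
  generalize Nat.find hex = L at hspec hmin
  have hL : 16 < L := by
    by_contra hcon
    have : 2 ^ L * L.factorial ≤ 2 ^ 16 * Nat.factorial 16 :=
      Nat.mul_le_mul (Nat.pow_le_pow_right (by norm_num) (not_lt.mp hcon))
        (Nat.factorial_le (not_lt.mp hcon))
    exact absurd (hspec.trans this) (not_le.mpr hn)
  refine ⟨L, hL.le, hspec, ?_⟩
  obtain ⟨m, rfl⟩ : ∃ m, L = m + 1 := ⟨L - 1, by omega⟩
  have hlow := hmin m (Nat.lt_succ_self m)
  have hhalf := Nat.mul_le_mul_right m.factorial (mul_two_pow_half_le hL.le)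
  have : 2 * (2 ^ ((m + 1) / 2) * (2 * (m + 1).factorial)) ≤ 2 * (2 ^ m * m.factorial) := by
    calc _ = (m + 1) * 2 ^ ((m + 1) / 2 + 2) * m.factorial := by
          rw [Nat.factorial_succ, pow_add]; ring
      _ ≤ 2 ^ (m + 1) * m.factorial := hhalf
      _ = _ := by ring
  omega

lemma exists_sparseMultipliers_sum {n : ℕ} (hn : 2 ^ 16 * Nat.factorial 16 < n) :
    ∃ (L : ℕ) (m : ℕ → ℕ), (∀ k < L, m k ∈ sparseMultipliers) ∧
      ∑ k ∈ Finset.range L, m k * (k + 1).factorial = n := by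
  obtain ⟨L, hL, hup, hlow⟩ := exists_scale hn
  set b := L / 2 with hb
  have hbase : ∑ k ∈ Finset.range L, 2 ^ b * (k + 1).factorial ≤ n := by
    rw [← Finset.mul_sum]
    exact (Nat.mul_le_mul_left _ (sum_factorial_le L)).trans hlow
  obtain ⟨R, hR⟩ := Nat.exists_eq_add_of_le hbase
  obtain ⟨x, r, hx, hxsum, hr⟩ := exists_greedy_approx L R
  have hfact : L.factorial < (L + 1).factorial :=
    (Nat.factorial_lt (by omega)).mpr (Nat.lt_succ_self L)
  have hrlt : r < (L + 1).factorial := by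
    rcases hr with h | h
    · exact h.trans hfact
    · have : 2 ^ L * r ≤ 2 ^ L * L.factorial := by
        rw [mul_comm]
        exact h.trans ((by omega : R ≤ n).trans hup)
      exact (Nat.le_of_mul_le_mul_left this (by positivity)).trans_lt hfact
  obtain ⟨v, hv, hvsum⟩ := exists_factorial_digits L r hrlt
  refine ⟨L, fun k => x k + 2 ^ b + v k, fun k hk => ⟨x k, b, v k, hx k, ?_, rfl⟩, ?_⟩
  · have := hv k
    omega
  · simp only [add_mul, Finset.sum_add_distrib]
    omega

lemma factorialReps_nonempty {n : ℕ} (hn : 2 ^ 16 * Nat.factorial 16 < n) :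
    (factorialReps n).Nonempty := by
  obtain ⟨L, m, hm, hsum⟩ := exists_sparseMultipliers_sum hn
  let e : ℕ ↪ ℕ := ⟨fun k => (k + 1).factorial, fun i j h => by
    by_contra hij
    exact hij (Nat.succ_injective ((Nat.factorial_inj' (by omega)).mp h))⟩
  let g : ℕ →₀ ℕ := Finsupp.indicator (Finset.range L) fun k _ => m k
  have hg : ∀ k < L, g k = m k := fun k hk =>
    Finsupp.indicator_of_mem (Finset.mem_range.mpr hk) _
  have hsupp : g.support ⊆ Finset.range L := Finsupp.support_indicator_subset _ _
  refine ⟨Finsupp.embDomain e g, ?_, ?_, ?_⟩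
  · intro a ha
    rw [Finsupp.support_embDomain, Finset.mem_coe, Finset.mem_map] at ha
    obtain ⟨k, -, rfl⟩ := ha
    exact ⟨k + 1, by omega, rfl⟩
  · intro a ha
    rw [Finsupp.support_embDomain, Finset.mem_map] at ha
    obtain ⟨k, hk, rfl⟩ := ha
    have hkL := Finset.mem_range.mp (hsupp hk)
    rw [Finsupp.embDomain_apply_self, hg k hkL]
    exact hm k hkL
  · rw [Finsupp.sum_embDomain, Finsupp.sum_of_support_subset g hsupp _ (by simp), ← hsum]
    exact Finset.sum_congr rfl fun k hk => by rw [hg k (Finset.mem_range.mp hk)]; rfl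

theorem stmt7 (A : Set ℕ) (hA : A = {x | ∃ k : ℕ, 1 ≤ k ∧ x = Nat.factorial k}) :
    ∃ (c : ℝ) (n₀ : ℕ) (M : Set ℕ), M.Infinite ∧ (∀ m ∈ M, 0 < m) ∧
      ∀ n : ℕ, n > n₀ → 0 < pCount A M n ∧ (pCount A M n : ℝ) ≤ (n : ℝ) ^ c := by
  refine ⟨(24 : ℕ), 2 ^ 16 * Nat.factorial 16, sparseMultipliers, sparseMultipliers_infinite,
    fun m => sparseMultipliers_pos, fun n hn => ?_⟩
  have hp : pCount A sparseMultipliers n = (factorialReps n).ncard := by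
    rw [hA]; rfl
  obtain ⟨K, hle, hlt⟩ := exists_factorial_le_lt (n := n) (by omega)
  obtain ⟨hfin, hcard⟩ := factorialReps_finite_ncard_le hlt
  have hK : 4 ≤ K := by
    by_contra hcon
    have h16 : (K + 1).factorial ≤ Nat.factorial 16 := Nat.factorial_le (by omega)
    omega
  rw [hp]
  refine ⟨(Set.ncard_pos hfin).mpr (factorialReps_nonempty hn), ?_⟩
  rw [Real.rpow_natCast]
  exact_mod_cast hcard.trans (log_pow_le_pow hK hle hlt)
end
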